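/- arXiv:1203.0922 — 2 statements merged into one kernel-verified Lean document; each statement's English description precedes it below -/
import Mathlib

section
/- Let M be a finite multiset over the positive integers of size n ≥ 2. Then, as polynomials in t, the sum over all Smirnov words w on M of t^{des(w)} equals the sum, over all multiset permutations w of M that have no double ascent and satisfy w_{n−1} > w_n, of t^{asc(w)}(1+t)^{n−1−2·asc(w)}. -/
attribute [local instance] Classical.propDecidable

open Polynomial

/-- The number of ascents of the word `w = w₁ ⋯ w_m`:
indices `i ∈ [m-1]` with `w_i ≤ w_{i+1}`. -/
noncomputable def ascF {m : ℕ} (w : Fin m → ℕ) : ℕ :=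
  (Finset.univ.filter fun i : Fin (m - 1) =>
      w ⟨(i : ℕ), by have := i.2; omega⟩ ≤ w ⟨(i : ℕ) + 1, by have := i.2; omega⟩).card

/-- The number of descents of the word `w = w₁ ⋯ w_m`:
indices `i ∈ [m-1]` with `w_i > w_{i+1}`. -/
noncomputable def desF {m : ℕ} (w : Fin m → ℕ) : ℕ :=
  (Finset.univ.filter fun i : Fin (m - 1) =>
      w ⟨(i : ℕ) + 1, by have := i.2; omega⟩ < w ⟨(i : ℕ), by have := i.2; omega⟩).card

/-- The word `w = w₁ ⋯ w_m` has no double ascent (no `i` with `w_i ≤ w_{i+1} ≤ w_{i+2}`). -/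
def NDAF {m : ℕ} (w : Fin m → ℕ) : Prop :=
  ∀ i : ℕ, ∀ h : i + 2 < m,
    ¬(w ⟨i, by omega⟩ ≤ w ⟨i + 1, by omega⟩ ∧ w ⟨i + 1, by omega⟩ ≤ w ⟨i + 2, h⟩)

/-- The word `w = w₁ ⋯ w_m` has no double descent (no `i` with `w_i > w_{i+1} > w_{i+2}`). -/
def NDDF {m : ℕ} (w : Fin m → ℕ) : Prop :=
  ∀ i : ℕ, ∀ h : i + 2 < m,
    ¬(w ⟨i + 1, by omega⟩ < w ⟨i, by omega⟩ ∧ w ⟨i + 2, h⟩ < w ⟨i + 1, by omega⟩)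

/-- The multiset permutations of the multiset encoded by its weakly increasing
arrangement `u`: all rearrangements `u ∘ σ` of `u`. -/
noncomputable def msPerms {n : ℕ} (u : Fin n → ℕ) : Finset (Fin n → ℕ) :=
  Finset.image (fun σ : Equiv.Perm (Fin n) => u ∘ σ) Finset.univ

/-- The number of excedances of the multiset permutation with top row `u` (weakly
increasing) and bottom row `w`: columns `j` with `w_j > u_j`. -/
noncomputable def excW {n : ℕ} (u w : Fin n → ℕ) : ℕ :=
  (Finset.univ.filter fun j : Fin n => u j < w j).card

/-- `w` is a Smirnov word: it has no two equal adjacent letters. -/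
def IsSmirnov {m : ℕ} (w : Fin m → ℕ) : Prop :=
  ∀ i : ℕ, ∀ h : i + 1 < m, w ⟨i, by omega⟩ ≠ w ⟨i + 1, h⟩

/-- Weight of a word for the Smirnov side. -/
noncomputable def phiX : List ℕ → Polynomial ℤ
  | [] => 1
  | [_] => 1
  | a :: b :: l => (if b < a then X else if a < b then 1 else 0) * phiX (b :: l)

/-- Weight of a word for the side without double ascents. -/
noncomputable def phiS : List ℕ → Polynomial ℤ
  | [] => 1
  | [_] => 1
  | [a, b] => if b < a then (X + 1) else 0
  | a :: b :: c :: l => if b < a then (X + 1) * phiS (b :: c :: l)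
      else if c < b then X * phiS (c :: l) else 0

lemma abstractX {R : Type*} [CommRing R] (k : ℕ) (x Y : ℕ → R) (t : R)
    (h : ∀ a < k, Y a = x a * (1 + t * ∑ b ∈ Finset.range a, Y b
      + ∑ b ∈ Finset.Ico (a + 1) k, Y b)) :
    (1 + t * ∑ b ∈ Finset.range k, Y b) * ∏ a ∈ Finset.range k, (1 + x a)
      = (1 + ∑ b ∈ Finset.range k, Y b) * ∏ a ∈ Finset.range k, (1 + t * x a) := by
  have key : ∀ j ≤ k, (1 + (∑ b ∈ Finset.range k, Y b) - (1 - t) * ∑ b ∈ Finset.range j, Y b)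
      * ∏ a ∈ Finset.range j, (1 + x a)
      = (1 + ∑ b ∈ Finset.range k, Y b) * ∏ a ∈ Finset.range j, (1 + t * x a) := by
    intro j
    induction j with
    | zero => intro _; simp
    | succ j ih =>
      intro hj
      have ih := ih (by omega)
      have hs := Finset.sum_range_add_sum_Ico Y hj
      have hh := h j (by omega)
      rw [Finset.sum_range_succ] at hs ⊢
      rw [Finset.prod_range_succ, Finset.prod_range_succ]
      generalize ∑ b ∈ Finset.range k, Y b = T at *
      generalize ∑ b ∈ Finset.range j, Y b = P at *
      generalize ∑ b ∈ Finset.Ico (j+1) k, Y b = Q at *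
      generalize ∏ a ∈ Finset.range j, (1 + x a) = E at *
      generalize ∏ a ∈ Finset.range j, (1 + t * x a) = F at *
      have e : Q = T - P - Y j := by rw [← hs]; ring
      subst e
      linear_combination (1 + t * x j) * ih - (1 - t) * E * hh
  have := key k le_rfl
  rw [← this]; ring

lemma abstractS {R : Type*} [CommRing R] (k : ℕ) (x Y : ℕ → R) (t : R)
    (h : ∀ a < k, Y a = x a * (1 + (t + 1) * ∑ b ∈ Finset.range a, Y b
      + t * ∑ b ∈ Finset.Ico a k, x b * ∑ c ∈ Finset.range b, Y c)) :
    (1 + t * ∑ b ∈ Finset.range k, Y b) * ∏ a ∈ Finset.range k, (1 + x a)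
      = (1 + ∑ b ∈ Finset.range k, Y b) * ∏ a ∈ Finset.range k, (1 + t * x a) := by
  have key : ∀ j ≤ k,
      (1 + (∑ b ∈ Finset.range j, Y b)
        + t * ∑ b ∈ Finset.Ico j k, x b * ∑ c ∈ Finset.range b, Y c)
      = (1 + t * ∑ b ∈ Finset.Ico 0 k, x b * ∑ c ∈ Finset.range b, Y c)
        * ∏ a ∈ Finset.range j, (1 + x a) ∧
      (1 + t * (∑ b ∈ Finset.range j, Y b)
        + t * ∑ b ∈ Finset.Ico j k, x b * ∑ c ∈ Finset.range b, Y c)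
      = (1 + t * ∑ b ∈ Finset.Ico 0 k, x b * ∑ c ∈ Finset.range b, Y c)
        * ∏ a ∈ Finset.range j, (1 + t * x a) := by
    intro j
    induction j with
    | zero => intro _; simp
    | succ j ih =>
      intro hj
      obtain ⟨ih1, ih2⟩ := ih (by omega)
      have hh := h j (by omega)
      have hs := Finset.sum_eq_sum_Ico_succ_bot (show j < k by omega)
        (fun b => x b * ∑ c ∈ Finset.range b, Y c)
      rw [Finset.sum_range_succ]
      rw [Finset.prod_range_succ, Finset.prod_range_succ]
      rw [hs] at hh ih1 ih2
      rw [hh]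
      constructor
      · linear_combination (1 + x j) * ih1
      · linear_combination (1 + t * x j) * ih2
  obtain ⟨h1, h2⟩ := key k le_rfl
  simp only [Finset.Ico_self, Finset.sum_empty, mul_zero, add_zero] at h1 h2
  rw [h1, h2]; ring

/-- Words of length `n` over `{0, …, k-1}`. -/
def wordsF (k n : ℕ) : Finset (Fin n → ℕ) := Fintype.piFinset (fun _ => Finset.range k)

lemma sum_wordsF_succ {B : Type*} [AddCommMonoid B] (k n : ℕ) (g : (Fin (n + 1) → ℕ) → B) :
    ∑ w ∈ wordsF k (n + 1), g w
      = ∑ a ∈ Finset.range k, ∑ w ∈ wordsF k n, g (Fin.cons a w) := by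
  rw [← Finset.sum_product']
  symm
  refine Finset.sum_nbij' (fun p => Fin.cons p.1 p.2) (fun w => (w 0, Fin.tail w)) ?_ ?_ ?_ ?_ ?_
  · rintro ⟨a, w⟩ h
    simp only [wordsF, Finset.mem_product, Fintype.mem_piFinset] at h ⊢
    intro i
    refine Fin.cases ?_ ?_ i
    · simpa using h.1
    · intro j; simpa using h.2 j
  · intro w h
    simp only [wordsF, Finset.mem_product, Fintype.mem_piFinset] at h ⊢
    exact ⟨h 0, fun i => h i.succ⟩
  · rintro ⟨a, w⟩ h
    simp
  · intro w h
    simp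
  · intro w h
    rfl

abbrev AA := MvPolynomial ℕ (Polynomial ℤ)

/-- Generating function of words with first letter `a` and `n` further letters. -/
noncomputable def gf (φ : List ℕ → Polynomial ℤ) (k n a : ℕ) : AA :=
  ∑ w ∈ wordsF k n, MvPolynomial.C (φ (a :: List.ofFn w)) *
    (MvPolynomial.X a * ∏ i, MvPolynomial.X (w i))

lemma gf_zero (φ : List ℕ → Polynomial ℤ) (k a : ℕ) :
    gf φ k 0 a = MvPolynomial.C (φ [a]) * MvPolynomial.X a := by
  simp [gf, wordsF]

lemma gf_succ (φ : List ℕ → Polynomial ℤ) (k n a : ℕ) :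
    gf φ k (n + 1) a = ∑ b ∈ Finset.range k, ∑ w ∈ wordsF k n,
      MvPolynomial.C (φ (a :: b :: List.ofFn w)) *
    (MvPolynomial.X a * (MvPolynomial.X b * ∏ i, MvPolynomial.X (w i))) := by
  rw [gf, sum_wordsF_succ]
  simp [List.ofFn_succ, Fin.prod_univ_succ]

lemma sum_split {B : Type*} [AddCommMonoid B] (k a : ℕ) (ha : a < k) (f : ℕ → B) :
    ∑ b ∈ Finset.range k, f b = ∑ b ∈ Finset.range a, f b
      + ∑ b ∈ Finset.Ico a k, f b :=
  (Finset.sum_range_add_sum_Ico f ha.le).symm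

lemma gfX_succ (k n a : ℕ) (ha : a < k) :
    gf phiX k (n + 1) a = MvPolynomial.X a * (MvPolynomial.C X * ∑ b ∈ Finset.range a, gf phiX k n b
      + ∑ b ∈ Finset.Ico (a + 1) k, gf phiX k n b) := by
  rw [gf_succ, sum_split k a ha, Finset.sum_eq_sum_Ico_succ_bot ha, mul_add]
  have h0 : (∑ w ∈ wordsF k n,
      MvPolynomial.C (phiX (a :: a :: List.ofFn w)) *
    ((MvPolynomial.X a : AA) * (MvPolynomial.X a * ∏ i, MvPolynomial.X (w i)))) = 0 := by
    apply Finset.sum_eq_zero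
    intro w _
    simp [phiX]
  rw [h0, zero_add]
  congr 1
  · rw [Finset.mul_sum, Finset.mul_sum]
    apply Finset.sum_congr rfl
    intro b hb
    rw [gf, Finset.mul_sum, Finset.mul_sum]
    apply Finset.sum_congr rfl
    intro w _
    rw [Finset.mem_range] at hb
    rw [phiX, if_pos hb, MvPolynomial.C_mul]
    ring
  · rw [Finset.mul_sum]
    apply Finset.sum_congr rfl
    intro b hb
    rw [gf, Finset.mul_sum]
    apply Finset.sum_congr rfl
    intro w _
    rw [Finset.mem_Ico] at hb
    rw [phiX, if_neg (by omega), if_pos (by omega), one_mul]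
    ring

lemma gfS_one (k a : ℕ) (ha : a < k) :
    gf phiS k 1 a = MvPolynomial.X a *
      (MvPolynomial.C (X + 1) * ∑ b ∈ Finset.range a, gf phiS k 0 b) := by
  rw [gf_succ, sum_split k a ha]
  have h0 : ∑ b ∈ Finset.Ico a k, (∑ w ∈ wordsF k 0,
      MvPolynomial.C (phiS (a :: b :: List.ofFn w)) *
    ((MvPolynomial.X a : AA) * (MvPolynomial.X b * ∏ i, MvPolynomial.X (w i)))) = 0 := by
    apply Finset.sum_eq_zero
    intro b hb
    apply Finset.sum_eq_zero
    intro w _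
    rw [Finset.mem_Ico] at hb
    simp only [List.ofFn_zero]
    rw [phiS, if_neg (by omega)]
    simp
  rw [h0, add_zero, Finset.mul_sum, Finset.mul_sum]
  apply Finset.sum_congr rfl
  intro b hb
  rw [gf, Finset.mul_sum, Finset.mul_sum]
  apply Finset.sum_congr rfl
  intro w _
  rw [Finset.mem_range] at hb
  simp only [List.ofFn_zero]
  rw [phiS, phiS, if_pos hb]
  simp only [map_one]
  ring

lemma gfS_succ (k n a : ℕ) (ha : a < k) :
    gf phiS k (n + 2) a = MvPolynomial.X a *
      (MvPolynomial.C (X + 1) * ∑ b ∈ Finset.range a, gf phiS k (n + 1) b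
      + MvPolynomial.C X * ∑ b ∈ Finset.Ico a k, MvPolynomial.X b *
        ∑ c ∈ Finset.range b, gf phiS k n c) := by
  rw [gf_succ, sum_split k a ha, mul_add]
  congr 1
  · rw [Finset.mul_sum, Finset.mul_sum]
    apply Finset.sum_congr rfl
    intro b hb
    rw [gf, Finset.mul_sum, Finset.mul_sum]
    apply Finset.sum_congr rfl
    intro w _
    rw [Finset.mem_range] at hb
    rw [List.ofFn_succ, phiS, if_pos hb, MvPolynomial.C_mul]
    ring
  · rw [Finset.mul_sum, Finset.mul_sum]
    apply Finset.sum_congr rfl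
    intro b hb
    rw [Finset.mem_Ico] at hb
    rw [sum_wordsF_succ, sum_split k b hb.2]
    have h0 : ∑ c ∈ Finset.Ico b k, (∑ w ∈ wordsF k n,
      MvPolynomial.C (phiS (a :: b :: List.ofFn (Fin.cons c w : Fin (n + 1) → ℕ))) *
      ((MvPolynomial.X a : AA) * (MvPolynomial.X b *
        ∏ i, MvPolynomial.X ((Fin.cons c w : Fin (n + 1) → ℕ) i)))) = 0 := by
      apply Finset.sum_eq_zero
      intro c hc
      apply Finset.sum_eq_zero
      intro w _
      rw [Finset.mem_Ico] at hc
      rw [List.ofFn_succ, Fin.cons_zero, phiS, if_neg (by omega), if_neg (by omega)]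
      simp
    rw [h0, add_zero, Finset.mul_sum, Finset.mul_sum, Finset.mul_sum]
    apply Finset.sum_congr rfl
    intro c hc
    rw [gf, Finset.mul_sum, Finset.mul_sum, Finset.mul_sum]
    apply Finset.sum_congr rfl
    intro w _
    rw [Finset.mem_range] at hc
    rw [List.ofFn_succ, Fin.cons_zero, phiS, if_neg (by omega), if_pos hc, MvPolynomial.C_mul,
      Fin.prod_univ_succ]
    simp only [Fin.cons_zero, Fin.cons_succ]
    ring

/-- The power series collecting `gf`. -/
noncomputable def ser (φ : List ℕ → Polynomial ℤ) (k a : ℕ) : PowerSeries AA :=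
  PowerSeries.X * PowerSeries.mk (fun n => gf φ k n a)

/-- The letter variable. -/
noncomputable def xv (a : ℕ) : PowerSeries AA :=
  PowerSeries.X * PowerSeries.C (MvPolynomial.X a)

/-- The variable `t`. -/
noncomputable def tv : PowerSeries AA := PowerSeries.C (MvPolynomial.C X)

lemma serX_eq (k a : ℕ) (ha : a < k) :
    ser phiX k a = xv a * (1 + tv * ∑ b ∈ Finset.range a, ser phiX k b
      + ∑ b ∈ Finset.Ico (a + 1) k, ser phiX k b) := by
  have : PowerSeries.mk (fun n => gf phiX k n a) = PowerSeries.C (MvPolynomial.X a) *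
      (1 + PowerSeries.X * (tv * ∑ b ∈ Finset.range a, PowerSeries.mk (fun n => gf phiX k n b)
      + ∑ b ∈ Finset.Ico (a + 1) k, PowerSeries.mk (fun n => gf phiX k n b))) := by
    ext1 n
    cases n with
    | zero => simp [PowerSeries.coeff_C_mul, gf_zero, phiX]
    | succ n =>
      rw [PowerSeries.coeff_mk, PowerSeries.coeff_C_mul, map_add, PowerSeries.coeff_succ_X_mul,
        gfX_succ k n a ha, map_add, tv, PowerSeries.coeff_C_mul, map_sum, map_sum]
      simp [PowerSeries.coeff_one]
  simp only [ser, xv]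
  rw [this, ← Finset.mul_sum, ← Finset.mul_sum]
  ring

lemma serS_eq (k a : ℕ) (ha : a < k) :
    ser phiS k a = xv a * (1 + (tv + 1) * ∑ b ∈ Finset.range a, ser phiS k b
      + tv * ∑ b ∈ Finset.Ico a k, xv b * ∑ c ∈ Finset.range b, ser phiS k c) := by
  have : PowerSeries.mk (fun n => gf phiS k n a) = PowerSeries.C (MvPolynomial.X a) *
      (1 + PowerSeries.X * (PowerSeries.C (MvPolynomial.C (X + 1)) *
          ∑ b ∈ Finset.range a, PowerSeries.mk (fun n => gf phiS k n b)
      + PowerSeries.X * (PowerSeries.C (MvPolynomial.C X) * ∑ b ∈ Finset.Ico a k,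
          PowerSeries.C (MvPolynomial.X b) *
          ∑ c ∈ Finset.range b, PowerSeries.mk (fun n => gf phiS k n c)))) := by
    ext1 n
    match n with
    | 0 => simp [PowerSeries.coeff_C_mul, gf_zero, phiS]
    | 1 =>
      rw [PowerSeries.coeff_mk, PowerSeries.coeff_C_mul, map_add, PowerSeries.coeff_succ_X_mul,
        gfS_one k a ha, map_add (PowerSeries.coeff 0), PowerSeries.coeff_C_mul, map_sum]
      simp [PowerSeries.coeff_one]
    | n + 2 =>
      rw [PowerSeries.coeff_mk, PowerSeries.coeff_C_mul, map_add, PowerSeries.coeff_succ_X_mul,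
        gfS_succ k n a ha, map_add (PowerSeries.coeff (n + 1)), PowerSeries.coeff_C_mul, map_sum,
        PowerSeries.coeff_succ_X_mul, PowerSeries.coeff_C_mul, map_sum]
      simp [PowerSeries.coeff_one, PowerSeries.coeff_C_mul]
  have ht : (PowerSeries.C (MvPolynomial.C (X + 1)) : PowerSeries AA) = tv + 1 := by simp [tv]
  rw [ht] at this
  simp only [ser, xv]
  rw [this, tv]
  simp only [← Finset.mul_sum]
  have e : ∀ b : ℕ, (PowerSeries.X * PowerSeries.C (MvPolynomial.X b : AA)) *
      (PowerSeries.X * ∑ c ∈ Finset.range b, PowerSeries.mk (fun n => gf phiS k n c))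
      = PowerSeries.X * PowerSeries.X * (PowerSeries.C (MvPolynomial.X b) *
      ∑ c ∈ Finset.range b, PowerSeries.mk (fun n => gf phiS k n c)) := by
    intro b; ring
  simp only [e, ← Finset.mul_sum]
  ring

lemma ser_sum_eq (k : ℕ) :
    ∑ a ∈ Finset.range k, ser phiX k a = ∑ a ∈ Finset.range k, ser phiS k a := by
  have h1 := abstractX k xv (ser phiX k) tv (fun a ha => serX_eq k a ha)
  have h2 := abstractS k xv (ser phiS k) tv (fun a ha => serS_eq k a ha)
  have hne : tv * ∏ a ∈ Finset.range k, (1 + xv a)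
      - ∏ a ∈ Finset.range k, (1 + tv * xv a) ≠ 0 := by
    intro h
    have := congrArg PowerSeries.constantCoeff h
    simp only [tv, xv, map_sub, map_mul, map_prod, map_add, map_one, map_zero,
      PowerSeries.constantCoeff_X, PowerSeries.constantCoeff_C, zero_mul, mul_zero, add_zero,
      Finset.prod_const_one, mul_one] at this
    have h3 := congrArg (MvPolynomial.coeff 0) this
    simp only [MvPolynomial.coeff_sub, MvPolynomial.coeff_zero_C, MvPolynomial.coeff_zero_one,
      MvPolynomial.coeff_zero] at h3
    have h4 := congrArg (Polynomial.eval 0) h3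
    simp at h4
  have h3 : (∑ a ∈ Finset.range k, ser phiX k a - ∑ a ∈ Finset.range k, ser phiS k a) *
      (tv * ∏ a ∈ Finset.range k, (1 + xv a)
      - ∏ a ∈ Finset.range k, (1 + tv * xv a)) = 0 := by
    linear_combination h1 - h2
  rcases mul_eq_zero.1 h3 with h | h
  · exact sub_eq_zero.1 h
  · exact absurd h hne

lemma gf_sum_eq (k n : ℕ) :
    ∑ a ∈ Finset.range k, gf phiX k n a = ∑ a ∈ Finset.range k, gf phiS k n a := by
  have h := congrArg (PowerSeries.coeff (n + 1)) (ser_sum_eq k)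
  simpa [ser, map_sum, PowerSeries.coeff_succ_X_mul] using h

lemma words_sum_eq (k n : ℕ) :
    ∑ w ∈ wordsF k (n + 1), MvPolynomial.C (phiX (List.ofFn w)) *
      (∏ i, MvPolynomial.X (w i) : AA)
    = ∑ w ∈ wordsF k (n + 1), MvPolynomial.C (phiS (List.ofFn w)) *
      (∏ i, MvPolynomial.X (w i) : AA) := by
  have h := gf_sum_eq k n
  simp only [gf] at h
  rw [sum_wordsF_succ, sum_wordsF_succ]
  simpa [List.ofFn_succ, Fin.prod_univ_succ] using h

lemma prod_X_eq {n : ℕ} (w : Fin n → ℕ) :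
    (∏ i, MvPolynomial.X (w i) : AA) =
      MvPolynomial.monomial (∑ i, Finsupp.single (w i) 1) 1 := by
  rw [MvPolynomial.monomial_sum_one]
  rfl

lemma coeff_words_eq (k n : ℕ) (φ : List ℕ → Polynomial ℤ) (m : ℕ →₀ ℕ) :
    MvPolynomial.coeff m (∑ w ∈ wordsF k n, MvPolynomial.C (φ (List.ofFn w)) *
      (∏ i, MvPolynomial.X (w i) : AA)) =
    ∑ w ∈ (wordsF k n).filter (fun w => ∑ i, Finsupp.single (w i) 1 = m), φ (List.ofFn w) := by
  rw [MvPolynomial.coeff_sum, Finset.sum_filter]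
  apply Finset.sum_congr rfl
  intro w _
  rw [prod_X_eq, MvPolynomial.coeff_C_mul, MvPolynomial.coeff_monomial]
  split_ifs <;> simp

lemma sum_singletons (n : ℕ) (v : Fin n → ℕ) :
    ∑ i, ({v i} : Multiset ℕ) = (List.ofFn v : Multiset ℕ) := by
  induction n with
  | zero => simp
  | succ n ih => rw [Fin.sum_univ_succ, ih, List.ofFn_succ]; rfl

lemma msPerms_eq {n k : ℕ} (u : Fin n → ℕ) (hk : ∀ i, u i < k) :
    (wordsF k n).filter (fun w => ∑ i, Finsupp.single (w i) 1
      = (∑ i, Finsupp.single (u i) 1 : ℕ →₀ ℕ)) = msPerms u := by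
  ext w
  simp only [Finset.mem_filter, wordsF, Fintype.mem_piFinset, Finset.mem_range, msPerms,
    Finset.mem_image, Finset.mem_univ, true_and]
  constructor
  · rintro ⟨_, h⟩
    have h2 : ∀ v : Fin n → ℕ, Finsupp.toMultiset (∑ i, Finsupp.single (v i) 1)
        = (List.ofFn v : Multiset ℕ) := by
      intro v
      rw [map_sum, ← sum_singletons]
      simp only [Finsupp.toMultiset_single, one_smul]
    have h3 := congrArg Finsupp.toMultiset h
    rw [h2, h2, Multiset.coe_eq_coe] at h3
    have h4 : w ∘ Tuple.sort w = u ∘ Tuple.sort u :=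
      List.ofFn_injective <|
        (((Tuple.sort w).ofFn_comp_perm w).trans
          (h3.trans ((Tuple.sort u).ofFn_comp_perm u).symm)).eq_of_pairwise'
          (Tuple.monotone_sort w).sortedLE_ofFn.pairwise
          (Tuple.monotone_sort u).sortedLE_ofFn.pairwise
    refine ⟨(Tuple.sort w).symm.trans (Tuple.sort u), ?_⟩
    funext i
    have := congrFun h4 ((Tuple.sort w).symm i)
    simpa using this.symm
  · rintro ⟨σ, rfl⟩
    refine ⟨fun i => hk _, ?_⟩
    exact Equiv.sum_comp σ (fun i => Finsupp.single (u i) 1)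

lemma phiX_ofFn (n : ℕ) (w : Fin (n + 1) → ℕ) :
    phiX (List.ofFn w) = if IsSmirnov w then X ^ desF w else 0 := by
  induction n with
  | zero =>
    have h : IsSmirnov w := fun i h => by omega
    rw [if_pos h]
    simp [phiX, desF]
  | succ n ih =>
    have h1 : desF w = (if w 1 < w 0 then 1 else 0) + desF (Fin.tail w) := by
      unfold desF
      rw [Finset.card_filter, Finset.card_filter]
      exact Fin.sum_univ_succ (n := n) _
    have h2 : IsSmirnov w ↔ w 0 ≠ w 1 ∧ IsSmirnov (Fin.tail w) := by
      constructor
      · intro h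
        exact ⟨h 0 (by omega), fun i hi => h (i + 1) (by omega)⟩
      · rintro ⟨h, h'⟩ i hi
        cases i with
        | zero => exact h
        | succ i => exact h' i (by omega)
    have h3 : phiX (List.ofFn w) = (if w 1 < w 0 then X else if w 0 < w 1 then 1 else 0) *
        phiX (List.ofFn (Fin.tail w)) := by
      rw [List.ofFn_succ, List.ofFn_succ, phiX, List.ofFn_succ (f := Fin.tail w)]
      rfl
    rw [h3, ih, h1]
    simp only [h2]
    rcases lt_trichotomy (w 0) (w 1) with h | h | h
    · simp [h, h.ne, h.not_gt]
    · simp [h]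
    · simp only [h, h.ne', if_true, ne_eq, not_false_eq_true, true_and, mul_ite, mul_zero]
      rw [pow_add, pow_one]

lemma ascF_succ {n : ℕ} (w : Fin (n + 2) → ℕ) :
    ascF w = (if w 0 ≤ w 1 then 1 else 0) + ascF (Fin.tail w) := by
  unfold ascF
  rw [Finset.card_filter, Finset.card_filter]
  exact Fin.sum_univ_succ (n := n) _

/-- Right-hand condition, as a predicate on words of length `n+1`. -/
def goodF {n : ℕ} (w : Fin (n + 1) → ℕ) : Prop :=
  NDAF w ∧ ∀ j, ∀ h : j + 1 = n, w ⟨j + 1, by omega⟩ < w ⟨j, by omega⟩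

lemma goodF_desc {n : ℕ} (w : Fin (n + 3) → ℕ) (h : w 1 < w 0) :
    goodF w ↔ goodF (Fin.tail w) := by
  constructor
  · rintro ⟨h1, h2⟩
    exact ⟨fun i hi => h1 (i + 1) (by omega), fun j hj => h2 (j + 1) (by omega)⟩
  · rintro ⟨h1, h2⟩
    refine ⟨fun i hi => ?_, fun j hj => ?_⟩
    · cases i with
      | zero => exact fun hh => absurd hh.1 (not_le.2 h)
      | succ i => exact h1 i (by omega)
    · cases j with
      | zero => omega
      | succ j => exact h2 j (by omega)

lemma goodF_asc {n : ℕ} (w : Fin (n + 3) → ℕ) (h : ¬ w 1 < w 0) :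
    goodF w ↔ w 2 < w 1 ∧ goodF (Fin.tail (Fin.tail w)) := by
  constructor
  · rintro ⟨h1, h2⟩
    refine ⟨?_, fun i hi => h1 (i + 2) (by omega), fun j hj => h2 (j + 2) (by omega)⟩
    have := h1 0 (by omega)
    by_contra h3
    exact this ⟨not_lt.1 h, not_lt.1 h3⟩
  · rintro ⟨h0, h1, h2⟩
    refine ⟨fun i hi => ?_, fun j hj => ?_⟩
    · match i with
      | 0 => exact fun hh => absurd hh.2 (not_le.2 h0)
      | 1 => exact fun hh => absurd hh.1 (not_le.2 h0)
      | i + 2 => exact h1 i (by omega)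
    · match j with
      | 0 => omega
      | 1 => exact h0
      | j + 2 => exact h2 j (by omega)

lemma phiS_ofFn (n : ℕ) : ∀ (w : Fin (n + 1) → ℕ),
    phiS (List.ofFn w) = (if goodF w then X ^ ascF w * (X + 1) ^ (n - 2 * ascF w) else 0) ∧
    (goodF w → 2 * ascF w ≤ n) := by
  induction n using Nat.strong_induction_on with
  | _ n ih =>
  match n with
  | 0 =>
    intro w
    have h : goodF w := ⟨fun i h => by omega, fun j h => by omega⟩
    rw [if_pos h]
    simp [phiS, ascF]
  | 1 =>
    intro w
    have h0 : ascF (Fin.tail w) = 0 := by simp [ascF]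
    have h1 : goodF w ↔ w 1 < w 0 := by
      constructor
      · rintro ⟨_, h⟩
        exact h 0 rfl
      · intro h
        refine ⟨fun i h => by omega, fun j hj => ?_⟩
        obtain rfl : j = 0 := by omega
        exact h
    have h3 : phiS (List.ofFn w) = if w 1 < w 0 then X + 1 else 0 := by
      rw [List.ofFn_succ, List.ofFn_succ, List.ofFn_zero, phiS]
      rfl
    rw [h3, h1, ascF_succ, h0]
    by_cases h : w 1 < w 0
    · simp [h, not_le.2 h]
    · simp [h]
  | n + 2 =>
    intro w
    have h3 : phiS (List.ofFn w) = if w 1 < w 0 then (X + 1) * phiS (List.ofFn (Fin.tail w))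
      else if w 2 < w 1 then X * phiS (List.ofFn (Fin.tail (Fin.tail w))) else 0 := by
      rw [List.ofFn_succ, List.ofFn_succ, List.ofFn_succ, phiS, List.ofFn_succ (f := Fin.tail w),
        List.ofFn_succ (f := Fin.tail (Fin.tail w)), List.ofFn_succ]
      rfl
    rw [h3]
    by_cases h : w 1 < w 0
    · obtain ⟨i1, i2⟩ := ih (n + 1) (by omega) (Fin.tail w)
      rw [if_pos h, i1, goodF_desc w h, ascF_succ w, if_neg (not_le.2 h), zero_add]
      refine ⟨?_, fun hh => (i2 hh).trans (by omega)⟩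
      split_ifs with hg
      · have := i2 hg
        rw [show n + 2 - 2 * ascF (Fin.tail w) = (n + 1 - 2 * ascF (Fin.tail w)) + 1 by omega,
          pow_succ]
        ring
      · simp
    · obtain ⟨i1, i2⟩ := ih n (by omega) (Fin.tail (Fin.tail w))
      rw [if_neg h, i1, goodF_asc w h, ascF_succ w, if_pos (not_lt.1 h)]
      by_cases h' : w 2 < w 1
      · have e : ascF (Fin.tail w) = ascF (Fin.tail (Fin.tail w)) := by
          rw [ascF_succ, if_neg, zero_add]
          exact not_le.2 h'
        rw [e, if_pos h']
        simp only [h', true_and]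
        refine ⟨?_, fun hh => by have := i2 hh; omega⟩
        split_ifs with hg
        · rw [show n + 2 - 2 * (1 + ascF (Fin.tail (Fin.tail w)))
            = n - 2 * ascF (Fin.tail (Fin.tail w)) by omega, pow_add]
          ring
        · simp
      · simp [h']

/-- Stanley/Gessel; eq. (7.6) of Linusson–Shareshian–Wachs.
For a finite multiset `M` over `ℙ` of size `n ≥ 2`, encoded by its weakly increasing
arrangement `u`, the polynomial identity
`∑_{w ∈ SW_M} t^{des w} = ∑ t^{asc w} (1+t)^{n-1-2 asc w}` holds, where the left sum is
over all Smirnov words on `M` and the right sum is over all multiset permutations `w` of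
`M` with no double ascent satisfying `w_{n-1} > w_n`. -/
theorem statement_6 (n : ℕ) (hn : 2 ≤ n) (u : Fin n → ℕ)
    (hmono : Monotone u) (hpos : ∀ i, 0 < u i) :
    (∑ w ∈ (msPerms u).filter (fun w => IsSmirnov w), (X : Polynomial ℤ) ^ desF w) =
      ∑ w ∈ (msPerms u).filter (fun w =>
          NDAF w ∧ w ⟨n - 1, by omega⟩ < w ⟨n - 2, by omega⟩),
        (X : Polynomial ℤ) ^ ascF w * (X + 1) ^ (n - 1 - 2 * ascF w) := by
  obtain ⟨n, rfl⟩ : ∃ m, n = m + 2 := ⟨n - 2, by omega⟩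
  obtain ⟨k, hk⟩ : ∃ k, ∀ i, u i < k :=
    ⟨u (Fin.last (n + 1)) + 1, fun i => Nat.lt_succ_of_le (hmono (Fin.le_last i))⟩
  have h := congrArg (MvPolynomial.coeff (∑ i, Finsupp.single (u i) 1)) (words_sum_eq k (n + 1))
  rw [coeff_words_eq, coeff_words_eq, msPerms_eq u hk] at h
  rw [Finset.sum_filter, Finset.sum_filter]
  refine (Finset.sum_congr rfl fun w _ => (phiX_ofFn (n + 1) w).symm).trans (h.trans ?_)
  refine Finset.sum_congr rfl fun w _ => ?_
  rw [(phiS_ofFn (n + 1) w).1]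
  have hg : goodF w ↔ (NDAF w ∧ w ⟨n + 2 - 1, by omega⟩ < w ⟨n + 2 - 2, by omega⟩) := by
    unfold goodF
    refine and_congr_right fun _ => ⟨fun h => h n rfl, fun h j hj => ?_⟩
    obtain rfl : j = n := by omega
    exact h
  simp only [hg]
  rfl
end

section
/- Let M be a finite multiset over the positive integers of size n ≥ 1, and write the polynomial Σ_{w a multiset derangement of M} t^{exc(w)} as Σ_{j=0}^{n} a_j t^j. Then a_j = a_{n−j} for all 0 ≤ j ≤ n, and the coefficient sequence is unimodal: a_0 ≤ a_1 ≤ ⋯ ≤ a_{⌊n/2⌋}. -/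
attribute [local instance] Classical.propDecidable

open Polynomial

namespace MD

/-! ### palindromic unimodal polynomials -/

noncomputable def ic (p : ℤ[X]) (z : ℤ) : ℤ := if z < 0 then 0 else p.coeff z.toNat

lemma ic_zero (z : ℤ) : ic 0 z = 0 := by simp [ic]

lemma ic_add (p q : ℤ[X]) (z : ℤ) : ic (p + q) z = ic p z + ic q z := by
  unfold ic; split_ifs <;> simp

lemma ic_sum {ι : Type*} (s : Finset ι) (p : ι → ℤ[X]) (z : ℤ) :
    ic (∑ i ∈ s, p i) z = ∑ i ∈ s, ic (p i) z := by
  unfold ic; split_ifs <;> simp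

lemma ic_X_pow_mul (i : ℕ) (p : ℤ[X]) (z : ℤ) : ic (X ^ i * p) z = ic p (z - i) := by
  unfold ic
  rw [Polynomial.coeff_X_pow_mul']
  split_ifs <;> first | rfl | omega | skip
  congr 1
  omega

def PU (n : ℤ) (f : ℤ → ℤ) : Prop :=
  (∀ z, f (n - z) = f z) ∧ ∀ z, 2 * (z + 1) ≤ n → f z ≤ f (z + 1)

lemma PU.mono {n : ℤ} {f : ℤ → ℤ} (h : PU n f) {a b : ℤ} (hab : a ≤ b) (hb : 2 * b ≤ n) :
    f a ≤ f b := by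
  induction b, hab using Int.leInduction with
  | base => rfl
  | succ b hab ih => exact (ih (by omega)).trans (h.2 b hb)

lemma PU.mono' {n : ℤ} {f : ℤ → ℤ} (h : PU n f) {a b : ℤ} (hab : a ≤ b) (hb : a + b ≤ n) :
    f a ≤ f b := by
  by_cases h2 : 2 * b ≤ n
  · exact h.mono hab h2
  · rw [← h.1 b]
    exact h.mono (by omega) (by omega)

lemma PU.sum {ι : Type*} {n : ℤ} (s : Finset ι) (f : ι → ℤ → ℤ) (h : ∀ i ∈ s, PU n (f i)) :
    PU n (fun z => ∑ i ∈ s, f i z) :=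
  ⟨fun z => Finset.sum_congr rfl fun i hi => (h i hi).1 z,
   fun z hz => Finset.sum_le_sum fun i hi => (h i hi).2 z hz⟩

lemma PU.qmul {n : ℤ} {f : ℤ → ℤ} (h : PU n f) (k : ℕ) (hk : 1 ≤ k) :
    PU (n + k) (fun z => ∑ i ∈ Finset.Ico 1 k, f (z - i)) := by
  constructor
  · intro z
    refine Finset.sum_nbij' (fun i => k - i) (fun i => k - i) ?_ ?_ ?_ ?_ ?_
    · intro i hi; simp at hi ⊢; omega
    · intro i hi; simp at hi ⊢; omega
    · intro i hi; simp at hi ⊢; omega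
    · intro i hi; simp at hi ⊢; omega
    · intro i hi
      simp at hi
      rw [← h.1]
      congr 1
      push_cast [Nat.cast_sub hi.2.le]
      ring
  · intro z hz
    have key : ∀ k : ℕ, 1 ≤ k → ∑ i ∈ Finset.Ico 1 k, f (z + 1 - i)
        = ∑ i ∈ Finset.Ico 1 k, f (z - i) + (f z - f (z + 1 - k)) := by
      intro k hk
      induction k, hk using Nat.le_induction with
      | base => simp
      | succ k hk ih =>
        rw [Finset.sum_Ico_succ_top hk, Finset.sum_Ico_succ_top hk, ih]
        have : z + 1 - ((k + 1 : ℕ) : ℤ) = z - k := by push_cast; ring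
        rw [this]; ring
    have := h.mono' (a := z + 1 - k) (b := z) (by omega) (by omega)
    simp only [key k hk]
    linarith

/-! ### The algebraic identity -/

lemma telescoping {R : Type*} [CommRing R] (t : R) (x : ℕ → R) (s : Finset ℕ) : ∀ B : R,
    (∏ i ∈ s, (x i + (∑ j ∈ s, (if i < j then t else if j < i then 1 else 0) * x j + B)))
      * (t * ∑ j ∈ s, x j + B)
    = (∏ i ∈ s, (t * x i + (∑ j ∈ s, (if i < j then t else if j < i then 1 else 0) * x j + B)))
      * (∑ j ∈ s, x j + B) := by
  induction s using Finset.induction_on_max with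
  | empty => intro B; simp
  | insert a s ha ih =>
    intro B
    have has : a ∉ s := fun h => lt_irrefl _ (ha a h)
    have h1 : ∑ j ∈ s, (if a < j then t else if j < a then 1 else 0) * x j = ∑ j ∈ s, x j := by
      refine Finset.sum_congr rfl fun j hj => ?_
      have := ha j hj
      rw [if_neg (by omega), if_pos this, one_mul]
    have h2 : ∀ c : R, ∏ i ∈ s, (c * x i + (∑ j ∈ insert a s,
          (if i < j then t else if j < i then 1 else 0) * x j + B))
        = ∏ i ∈ s, (c * x i + (∑ j ∈ s,
          (if i < j then t else if j < i then 1 else 0) * x j + (B + t * x a))) := by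
      intro c
      refine Finset.prod_congr rfl fun i hi => ?_
      rw [Finset.sum_insert has, if_pos (ha i hi)]
      ring
    have h3 := h2 1
    simp only [one_mul] at h3
    rw [Finset.prod_insert has, Finset.prod_insert has, h2 t, h3]
    simp only [Finset.sum_insert has, h1, lt_irrefl, if_false, zero_mul, zero_add]
    have := ih (B + t * x a)
    linear_combination (x a + (∑ j ∈ s, x j + B)) * this

noncomputable def wt (i j : ℕ) : ℤ[X] := if i < j then X else if j < i then 1 else 0

noncomputable def L (s : Finset ℕ) (i : ℕ) : MvPolynomial ℕ ℤ[X] :=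
  ∑ j ∈ s, MvPolynomial.C (wt i j) * MvPolynomial.X j

noncomputable def q (k : ℕ) : ℤ[X] := ∑ i ∈ Finset.Ico 1 k, X ^ i

lemma q_mul (k : ℕ) (hk : 1 ≤ k) : (X - 1) * q k = X ^ k - X := by
  unfold q
  induction k, hk using Nat.le_induction with
  | base => simp
  | succ k hk ih => rw [Finset.sum_Ico_succ_top hk, mul_add, ih]; ring

lemma sumX_ne (s : Finset ℕ) (hs : s.Nonempty) :
    (∑ j ∈ s, MvPolynomial.X j : MvPolynomial ℕ ℤ[X]) ≠ 0 := by
  obtain ⟨a, ha⟩ := hs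
  intro h
  have := congrArg (MvPolynomial.coeff (Finsupp.single a 1)) h
  simp [MvPolynomial.coeff_sum, MvPolynomial.coeff_X, Finsupp.single_left_inj, ha] at this

noncomputable def cf (k : ℕ) : ℤ[X] := if k = 0 then 1 else - q k

lemma cf_mul (k : ℕ) : (X - 1) * cf k = X - X ^ k := by
  unfold cf
  split_ifs with h
  · simp [h]
  · rw [mul_neg, q_mul k (by omega)]; ring

lemma key_zero (s : Finset ℕ) (hs : s.Nonempty) :
    ∑ T ∈ s.powerset, MvPolynomial.C (cf T.card) *
      ((∏ i ∈ T, (MvPolynomial.X i : MvPolynomial ℕ ℤ[X])) * ∏ i ∈ s \ T, L s i) = 0 := by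
  have h0 : (MvPolynomial.C (X - 1 : ℤ[X]) : MvPolynomial ℕ ℤ[X]) ≠ 0 := by
    rw [Ne, MvPolynomial.C_eq_zero]
    exact Polynomial.X_sub_C_ne_zero (1 : ℤ)
  have tel := telescoping (MvPolynomial.C (X : ℤ[X]) : MvPolynomial ℕ ℤ[X])
    (fun i => MvPolynomial.X i) s 0
  have hL : ∀ i, ∑ j ∈ s, (if i < j then MvPolynomial.C (X : ℤ[X]) else if j < i then 1 else 0)
      * (MvPolynomial.X j : MvPolynomial ℕ ℤ[X]) = L s i := by
    intro i
    unfold L wt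
    refine Finset.sum_congr rfl fun j _ => ?_
    split_ifs <;> simp
  simp only [hL, add_zero] at tel
  rw [← mul_assoc] at tel
  have tel2 := mul_right_cancel₀ (sumX_ne s hs) tel
  rw [Finset.prod_add, Finset.prod_add] at tel2
  refine (mul_eq_zero.1 ?_).resolve_left h0
  rw [Finset.mul_sum]
  have : ∀ T ∈ s.powerset, MvPolynomial.C (X - 1 : ℤ[X]) * (MvPolynomial.C (cf T.card) *
      ((∏ i ∈ T, (MvPolynomial.X i : MvPolynomial ℕ ℤ[X])) * ∏ i ∈ s \ T, L s i))
      = ((∏ i ∈ T, (MvPolynomial.X i : MvPolynomial ℕ ℤ[X])) * ∏ i ∈ s \ T, L s i)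
        * MvPolynomial.C (X : ℤ[X])
      - (∏ i ∈ T, (MvPolynomial.C (X : ℤ[X]) * MvPolynomial.X i : MvPolynomial ℕ ℤ[X]))
        * ∏ i ∈ s \ T, L s i := by
    intro T _
    rw [← mul_assoc, ← MvPolynomial.C_mul, cf_mul, Finset.prod_mul_distrib, Finset.prod_const]
    simp only [map_sub, map_pow]
    ring
  rw [Finset.sum_congr rfl this, Finset.sum_sub_distrib, ← Finset.sum_mul, tel2, sub_self]

/-! ### independence of alphabet and the recurrence -/

lemma coeff_indep (s s' : Finset ℕ) (hss : s ⊆ s') (U : Multiset ℕ) : ∀ m : ℕ →₀ ℕ, m.support ⊆ s →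
    MvPolynomial.coeff m (U.map (L s')).prod = MvPolynomial.coeff m (U.map (L s)).prod := by
  induction U using Multiset.induction_on with
  | empty => intro m _; simp
  | cons a U ih =>
    intro m hm
    simp only [Multiset.map_cons, Multiset.prod_cons]
    have e : ∀ s : Finset ℕ, ∀ Q : MvPolynomial ℕ ℤ[X], MvPolynomial.coeff m (L s a * Q)
        = ∑ j ∈ s, wt a j * (if j ∈ m.support then
            MvPolynomial.coeff (m - Finsupp.single j 1) Q else 0) := by
      intro s Q
      unfold L
      rw [Finset.sum_mul, MvPolynomial.coeff_sum]
      refine Finset.sum_congr rfl fun j _ => ?_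
      rw [mul_assoc, MvPolynomial.coeff_C_mul, MvPolynomial.coeff_X_mul']
    rw [e, e]
    symm
    rw [← Finset.sum_subset hss]
    · refine Finset.sum_congr rfl fun j _ => ?_
      rw [ih]
      exact (Finsupp.support_tsub).trans hm
    · intro j _ hj
      rw [if_neg (fun h => hj (hm h)), mul_zero]

noncomputable def P (s : Finset ℕ) (m : ℕ →₀ ℕ) : ℤ[X] :=
  MvPolynomial.coeff m (∏ i ∈ s, L s i ^ m i)

noncomputable def D (m : ℕ →₀ ℕ) : ℤ[X] := P m.support m

lemma P_eq_D (s : Finset ℕ) (m : ℕ →₀ ℕ) (h : m.support ⊆ s) : P s m = D m := by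
  have e : ∀ s s' : Finset ℕ, m.support ⊆ s →
      ∏ i ∈ s, L s' i ^ m i = ((Finsupp.toMultiset m).map (L s')).prod := by
    intro s s' h
    rw [Finsupp.toMultiset_map, Finsupp.prod_toMultiset,
      Finsupp.prod_mapDomain_index (by simp) (by intros; rw [pow_add]), Finsupp.prod]
    symm
    refine Finset.prod_subset h ?_
    intro i _ hi
    rw [Finsupp.notMem_support_iff.1 hi, pow_zero]
  unfold D P
  rw [e s s h, e m.support m.support subset_rfl]
  exact coeff_indep _ _ h _ m subset_rfl

noncomputable def ind (T : Finset ℕ) : ℕ →₀ ℕ := ∑ i ∈ T, Finsupp.single i 1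

lemma ind_apply (T : Finset ℕ) (i : ℕ) : ind T i = if i ∈ T then 1 else 0 := by
  simp [ind, Finsupp.finsetSum_apply, Finsupp.single_apply]

lemma ind_le (m : ℕ →₀ ℕ) (T : Finset ℕ) (h : T ⊆ m.support) : ind T ≤ m := by
  intro i
  rw [ind_apply]
  split_ifs with hi
  · have := Finsupp.mem_support_iff.1 (h hi); omega
  · omega

lemma D_rec (m : ℕ →₀ ℕ) (hm : m ≠ 0) :
    D m = ∑ T ∈ m.support.powerset.erase ∅, q T.card * D (m - ind T) := by
  have hs : m.support.Nonempty := by rwa [Finsupp.support_nonempty_iff]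
  have hz := key_zero m.support hs
  have hz2 := congrArg (fun p => MvPolynomial.coeff m
    (p * ∏ i ∈ m.support, L m.support i ^ (m i - 1))) hz
  simp only [Finset.sum_mul, MvPolynomial.coeff_sum, zero_mul, MvPolynomial.coeff_zero] at hz2
  have : ∀ T ∈ m.support.powerset, MvPolynomial.coeff m (MvPolynomial.C (cf T.card) *
      ((∏ i ∈ T, (MvPolynomial.X i : MvPolynomial ℕ ℤ[X])) * ∏ i ∈ m.support \ T, L m.support i)
      * ∏ i ∈ m.support, L m.support i ^ (m i - 1)) = cf T.card * D (m - ind T) := by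
    intro T hT
    have hT' := Finset.mem_powerset.1 hT
    have e1 : (∏ i ∈ T, (MvPolynomial.X i : MvPolynomial ℕ ℤ[X]))
        = MvPolynomial.monomial (ind T) 1 := by
      rw [ind, MvPolynomial.monomial_sum_one]
      rfl
    have e2 : (∏ i ∈ m.support \ T, L m.support i) * ∏ i ∈ m.support, L m.support i ^ (m i - 1)
        = ∏ i ∈ m.support, L m.support i ^ (m - ind T) i := by
      rw [← Finset.prod_sdiff hT', ← Finset.prod_sdiff hT', ← mul_assoc, ← Finset.prod_mul_distrib]
      congr 1
      · refine Finset.prod_congr rfl fun i hi => ?_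
        rw [Finset.mem_sdiff] at hi
        have := Finsupp.mem_support_iff.1 hi.1
        rw [Finsupp.tsub_apply, ind_apply, if_neg hi.2, ← pow_succ']
        congr 1; omega
      · refine Finset.prod_congr rfl fun i hi => ?_
        rw [Finsupp.tsub_apply, ind_apply, if_pos hi]
    rw [mul_assoc, MvPolynomial.coeff_C_mul, mul_assoc, e2, e1, MvPolynomial.coeff_monomial_mul',
      if_pos (ind_le m T hT'), one_mul]
    congr 1
    exact P_eq_D _ _ Finsupp.support_tsub
  rw [Finset.sum_congr rfl this, ← Finset.add_sum_erase _ _ (Finset.empty_mem_powerset _)] at hz2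
  have e3 : m - ind ∅ = m := by simp [ind]
  rw [e3, Finset.card_empty, cf, if_pos rfl, one_mul] at hz2
  rw [eq_neg_of_add_eq_zero_left hz2, ← Finset.sum_neg_distrib]
  refine Finset.sum_congr rfl fun T hT => ?_
  rw [cf, if_neg, neg_mul, neg_neg]
  rw [Finset.card_eq_zero]
  exact (Finset.mem_erase.1 hT).1

lemma degree_ind (T : Finset ℕ) : (ind T).degree = T.card := by
  simp [ind, map_sum, Finsupp.degree_single]

lemma D_PU (N : ℕ) : ∀ m : ℕ →₀ ℕ, m.degree = N → PU N (ic (D m)) := by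
  induction N using Nat.strong_induction_on with
  | _ N ih =>
    intro m hN
    by_cases hm : m = 0
    · subst hm
      have : N = 0 := by rw [← hN]; simp
      subst this
      have : D 0 = 1 := by simp [D, P]
      rw [this]
      have e : ∀ z, ic 1 z = if z = 0 then 1 else 0 := by
        intro z
        simp only [ic, Polynomial.coeff_one]
        split_ifs <;> first | rfl | omega
      constructor
      · intro z; simp [e]
      · intro z hz; simp only [e]; split_ifs <;> simp at * <;> omega
    · have : ic (D m) = fun z => ∑ T ∈ m.support.powerset.erase ∅,
          ∑ i ∈ Finset.Ico 1 T.card, ic (D (m - ind T)) (z - i) := by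
        funext z
        rw [D_rec m hm, ic_sum]
        refine Finset.sum_congr rfl fun T _ => ?_
        rw [q, Finset.sum_mul, ic_sum]
        exact Finset.sum_congr rfl fun i _ => ic_X_pow_mul _ _ _
      rw [this]
      refine PU.sum _ (fun T z => ∑ i ∈ Finset.Ico 1 T.card, ic (D (m - ind T)) (z - i)) ?_
      intro T hT
      rw [Finset.mem_erase, Finset.mem_powerset] at hT
      have hc : 1 ≤ T.card := Finset.card_pos.2 (Finset.nonempty_iff_ne_empty.2 hT.1)
      have hd : (m - ind T).degree + T.card = N := by
        rw [← degree_ind T, ← map_add, tsub_add_cancel_of_le (ind_le m T hT.2), hN]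
      have := (ih (m - ind T).degree (by omega) _ rfl).qmul T.card hc
      rw [← hd]
      push_cast
      exact this

/-! ### words -/

noncomputable def content {n : ℕ} (u : Fin n → ℕ) : ℕ →₀ ℕ := ∑ k, Finsupp.single (u k) 1

lemma content_apply {n : ℕ} (u : Fin n → ℕ) (i : ℕ) :
    content u i = Fintype.card { k // u k = i } := by
  simp [content, Finsupp.finsetSum_apply, Finsupp.single_apply, Fintype.card_subtype]

lemma content_iff {n : ℕ} (u w : Fin n → ℕ) :
    content w = content u ↔ w ∈ Finset.image (fun σ : Equiv.Perm (Fin n) => u ∘ σ) Finset.univ := by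
  simp only [Finset.mem_image, Finset.mem_univ, true_and]
  constructor
  · intro h
    have h' : ∀ i, Nonempty ({ k // w k = i } ≃ { k // u k = i }) := by
      intro i
      rw [← Fintype.card_eq, ← content_apply, ← content_apply, h]
    refine ⟨Equiv.ofFiberEquiv fun i => (h' i).some, ?_⟩
    funext k
    exact Equiv.ofFiberEquiv_map (fun i => (h' i).some) k
  · rintro ⟨σ, rfl⟩
    exact Equiv.sum_comp σ (fun k => Finsupp.single (u k) 1)

lemma prod_wt {n : ℕ} (u w : Fin n → ℕ) :
    ∏ k, wt (u k) (w k) = if ∀ j, w j ≠ u j then X ^ excW u w else 0 := by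
  split_ifs with h
  · have : ∀ k, wt (u k) (w k) = if u k < w k then X else 1 := by
      intro k
      have := h k
      unfold wt
      split_ifs <;> first | rfl | omega
    simp only [this]
    rw [Finset.prod_ite, Finset.prod_const, Finset.prod_const_one, mul_one, excW]
  · push Not at h
    obtain ⟨k, hk⟩ := h
    exact Finset.prod_eq_zero (Finset.mem_univ k) (by simp [wt, hk])

lemma D_words {n : ℕ} (u : Fin n → ℕ) :
    D (content u) = ∑ w ∈ (Finset.image (fun σ : Equiv.Perm (Fin n) => u ∘ σ) Finset.univ),
      ∏ k, wt (u k) (w k) := by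
  set s := Finset.univ.image u with hs
  have hsupp : (content u).support ⊆ s := by
    refine (Finsupp.support_finsetSum).trans ?_
    intro i hi
    simp [hs, Finsupp.single_apply] at hi ⊢
    aesop
  rw [← P_eq_D s _ hsupp, P]
  have h1 : ∏ i ∈ s, L s i ^ content u i = ∏ k, L s (u k) := by
    rw [Finset.prod_comp (L s) u]
    refine Finset.prod_congr rfl fun i _ => ?_
    congr 1
    simp [content, Finsupp.finsetSum_apply, Finsupp.single_apply]
  rw [h1]
  unfold L
  rw [Finset.prod_univ_sum, MvPolynomial.coeff_sum]
  have h2 : ∀ w : Fin n → ℕ, MvPolynomial.coeff (content u)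
      (∏ k, MvPolynomial.C (wt (u k) (w k)) * (MvPolynomial.X (w k) : MvPolynomial ℕ ℤ[X]))
      = if content w = content u then ∏ k, wt (u k) (w k) else 0 := by
    intro w
    have : ∏ k, (MvPolynomial.X (w k) : MvPolynomial ℕ ℤ[X])
        = MvPolynomial.monomial (content w) 1 := by
      rw [content, MvPolynomial.monomial_sum_one]
      rfl
    rw [Finset.prod_mul_distrib, this, ← map_prod, MvPolynomial.coeff_C_mul,
      MvPolynomial.coeff_monomial]
    simp
  simp only [h2, content_iff]
  rw [← Finset.sum_filter]
  refine Finset.sum_congr ?_ fun _ _ => rfl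
  ext w
  simp only [Finset.mem_filter, and_iff_right_iff_imp, Fintype.mem_piFinset, Finset.mem_image,
    Finset.mem_univ, true_and, hs]
  rintro ⟨σ, rfl⟩ k
  exact ⟨σ k, rfl⟩

end MD

/-- Remark 5.2 of Linusson–Shareshian–Wachs: the excedance polynomial
`∑_{w ∈ MD_M} t^{exc w}` of the multiset derangements of a multiset `M` of size `n ≥ 1`
(encoded by its weakly increasing arrangement `u`), written as `∑_{j=0}^n a_j t^j`, is
palindromic (`a_j = a_{n-j}`) and its coefficient sequence is unimodal
(`a_0 ≤ a_1 ≤ ⋯ ≤ a_{⌊n/2⌋}`). -/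
theorem statement_7 (n : ℕ) (hn : 1 ≤ n) (u : Fin n → ℕ)
    (hmono : Monotone u) (hpos : ∀ i, 0 < u i)
    (a : ℕ → ℕ)
    (ha : ∀ j, a j =
      (∑ w ∈ (msPerms u).filter (fun w => ∀ j, w j ≠ u j),
        (X : Polynomial ℕ) ^ excW u w).coeff j) :
    (∀ j ≤ n, a j = a (n - j)) ∧ ∀ j : ℕ, j + 1 ≤ n / 2 → a j ≤ a (j + 1) := by
  have hD : ∀ j, (a j : ℤ) = (MD.D (MD.content u)).coeff j := by
    intro j
    rw [MD.D_words, ha j]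
    have e : (∑ w ∈ Finset.image (fun σ : Equiv.Perm (Fin n) => u ∘ σ) Finset.univ,
        ∏ k, MD.wt (u k) (w k))
        = (∑ w ∈ (msPerms u).filter (fun w => ∀ j, w j ≠ u j),
          (X : Polynomial ℕ) ^ excW u w).map (Nat.castRingHom ℤ) := by
      rw [Polynomial.map_sum, Finset.sum_filter]
      refine Finset.sum_congr rfl fun w _ => ?_
      rw [MD.prod_wt]
      split_ifs <;> simp
    rw [e, Polynomial.coeff_map]
    rfl
  have hdeg : (MD.content u).degree = n := by
    simp [MD.content, map_sum, Finsupp.degree_single]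
  have hPU := MD.D_PU n (MD.content u) hdeg
  have hic : ∀ j : ℕ, MD.ic (MD.D (MD.content u)) j = a j := by
    intro j
    rw [hD j, MD.ic, if_neg (by omega), Int.toNat_natCast]
  constructor
  · intro j hj
    have := hPU.1 j
    rw [← Nat.cast_sub hj, hic, hic] at this
    exact_mod_cast this.symm
  · intro j hj
    have := hPU.2 j (by omega)
    rw [← Nat.cast_succ, hic, hic] at this
    exact_mod_cast this
end
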